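/- If a path q ∈ H¹([0,1],χ) has a total collision at an endpoint, i.e. q₁(t₀) = q₂(t₀) = q₃(t₀) = q₄(t₀) for t₀ = 0 or t₀ = 1, then its action satisfies A(q) ≥ (6/4)·(3/2)·(16π²)^{1/3}, and in particular A(q) ≥ 12.16. -/

import Mathlib

open Real MeasureTheory Set
open scoped ENNReal

noncomputable section

/-- Euclidean norm on `ℝ × ℝ` (row vectors in the plane). -/
def enorm2 (v : ℝ × ℝ) : ℝ := Real.sqrt (v.1 ^ 2 + v.2 ^ 2)

/-- Row vector multiplied on the right by the rotation matrix `R θ`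
with rows `(cos θ, sin θ)` and `(-sin θ, cos θ)`. -/
def rotV (θ : ℝ) (v : ℝ × ℝ) : ℝ × ℝ :=
  (v.1 * Real.cos θ - v.2 * Real.sin θ, v.1 * Real.sin θ + v.2 * Real.cos θ)

/-- `H¹([0,1],(ℝ²)⁴)`: absolutely continuous paths `[0,1] → (ℝ²)⁴` with
square-integrable derivative, recorded via an integrable (a.e.-)derivative `v`
together with the integral representation of `q`. -/
structure H1Path4 where
  q : ℝ → Fin 4 → ℝ × ℝ
  v : ℝ → Fin 4 → ℝ × ℝ
  hvInt : ∀ i : Fin 4, IntegrableOn (fun t => v t i) (Icc (0:ℝ) 1)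
  hrep : ∀ i : Fin 4, ∀ t ∈ Icc (0:ℝ) 1, q t i = q 0 i + ∫ s in (0:ℝ)..t, v s i
  hL2 : ∀ i : Fin 4, IntegrableOn (fun t => enorm2 (v t i) ^ 2) (Icc (0:ℝ) 1)

/-- Center of mass at the origin throughout `[0,1]` (the path lies in `χ`). -/
def H1Path4.inChi (p : H1Path4) : Prop := ∀ t ∈ Icc (0:ℝ) 1, ∑ i, p.q t i = 0

/-- The Lagrangian action functional `A`, with value `+∞` allowed. -/
def action (p : H1Path4) : ℝ≥0∞ :=
  ∫⁻ t in Icc (0:ℝ) 1,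
    (ENNReal.ofReal ((1/2) * ∑ i, enorm2 (p.v t i) ^ 2)
      + ∑ i : Fin 4, ∑ j ∈ Finset.univ.filter (fun j => i < j),
          (ENNReal.ofReal (enorm2 (p.q t i - p.q t j)))⁻¹)

/-- The starting boundary configuration set `Q_S` (double isosceles with order
constraints). -/
def QSset : Set (Fin 4 → ℝ × ℝ) :=
  { c | ∃ a₁ b₁ c₁ : ℝ, 0 ≤ b₁ ∧ 0 ≤ c₁ ∧
      c = ![(-a₁ - c₁, 0), (-a₁, 0), ((2*a₁ + c₁)/2, b₁), ((2*a₁ + c₁)/2, -b₁)] }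

/-- The ending boundary configuration set `Q_{E₁}`. -/
def QE1set (θ : ℝ) : Set (Fin 4 → ℝ × ℝ) :=
  { c | ∃ a₂ b₂ c₂ : ℝ, 0 ≤ b₂ ∧ 0 ≤ c₂ ∧
      c = fun i => rotV θ (![(-b₂, -a₂), (-c₂, a₂), (c₂, a₂), (b₂, -a₂)] i) }

/-- The ending boundary configuration set `Q_{E₂}`. -/
def QE2set (θ : ℝ) : Set (Fin 4 → ℝ × ℝ) :=
  { c | ∃ a₂ b₂ c₂ : ℝ, 0 ≤ b₂ ∧ 0 ≤ c₂ ∧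
      c = fun i => rotV θ (![(-a₂, -b₂), (-a₂, b₂), (a₂, c₂), (a₂, -c₂)] i) }

/-- Membership in the admissible class `P(Q_S, E)`. -/
def inAdm (E : Set (Fin 4 → ℝ × ℝ)) (p : H1Path4) : Prop :=
  p.inChi ∧ p.q 0 ∈ QSset ∧ p.q 1 ∈ E

/-- `p` is an action minimizer over `P(Q_S, E)`. -/
def isMin (E : Set (Fin 4 → ℝ × ℝ)) (p : H1Path4) : Prop :=
  inAdm E p ∧ ∀ p' : H1Path4, inAdm E p' → action p ≤ action p'

/-- The Newtonian equations of the equal-mass four-body problem, on a set `s`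
of times. -/
def newton (Q : ℝ → Fin 4 → ℝ × ℝ) (s : Set ℝ) : Prop :=
  ∀ i : Fin 4, ∀ t ∈ s,
    deriv (deriv (fun u => Q u i)) t =
      ∑ j ∈ Finset.univ.erase i, (1 / enorm2 (Q t j - Q t i) ^ 3) • (Q t j - Q t i)

/-- A Riccati-type completion of squares along `L t = ∫₀ᵗ w`: with the regularised fictitious time
`σ t = ∫₀ᵗ 1 / (L + η)`, the function `2k cot (k (σ + δ))` calibrates the kinetic energy. -/
lemma half_integral_sq_ge_of_integral_inv_le {w : ℝ → ℝ} (hw : Integrable w) (hw0 : ∀ t, 0 ≤ w t)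
    (hw2 : Integrable fun t => w t ^ 2) {η δ S : ℝ} (hη : 0 < η) (hδ : 0 < δ)
    (hS : ∫ t in (0:ℝ)..1, 1 / ((∫ s in (0:ℝ)..t, w s) + η) ≤ S) :
    2 * (π / (2 * (S + δ))) ^ 2
      - 2 * (π / (2 * (S + δ))) * (cos (π / (2 * (S + δ)) * δ) / sin (π / (2 * (S + δ)) * δ)) * η
      ≤ 1 / 2 * ∫ t in (0:ℝ)..1, w t ^ 2 := by
  set k := π / (2 * (S + δ)) with hk
  set L : ℝ → ℝ := fun t => (∫ s in (0:ℝ)..t, w s) + η with hL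
  set M : ℝ → ℝ := fun t => |∫ s in (0:ℝ)..t, w s| + η with hM
  have hprim : Continuous fun t => ∫ s in (0:ℝ)..t, w s :=
    intervalIntegral.continuous_primitive (fun a b => hw.intervalIntegrable) 0
  have hMpos : ∀ t, 0 < M t := fun t => by positivity
  have hMinv : Continuous fun t => 1 / M t :=
    continuous_const.div (hprim.abs.add continuous_const) fun t => (hMpos t).ne'
  have hML : ∀ t, 0 ≤ t → M t = L t := fun t ht => by
    simp only [hM, hL, abs_of_nonneg (intervalIntegral.integral_nonneg ht fun s _ => hw0 s)]
  set σ : ℝ → ℝ := fun t => ∫ s in (0:ℝ)..t, 1 / M s with hσ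
  have hσd : ∀ t, HasDerivAt σ (1 / M t) t := fun t => hMinv.integral_hasStrictDerivAt 0 t |>.hasDerivAt
  have hσmono : Monotone σ := monotone_of_deriv_nonneg (fun t => (hσd t).differentiableAt)
    fun t => by rw [(hσd t).deriv]; exact (one_div_pos.2 (hMpos t)).le
  have hσ0 : σ 0 = 0 := intervalIntegral.integral_same
  have hσ1 : σ 1 ≤ S := by
    refine le_of_eq_of_le (intervalIntegral.integral_congr fun t ht => ?_) hS
    rw [uIcc_of_le zero_le_one] at ht
    simp only [hML t ht.1, hL]
  have hS0 : 0 ≤ S := by linarith [hσmono zero_le_one]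
  have hSδ : 0 < S + δ := by linarith
  have hkpos : 0 < k := by positivity
  have hkS : k * (S + δ) = π / 2 := by rw [hk]; field_simp
  have hσC : ContDiff ℝ 1 σ := contDiff_one_iff_deriv.2
    ⟨fun t => (hσd t).differentiableAt, by rwa [funext fun t => (hσd t).deriv]⟩
  have hang : ∀ t ∈ Icc (0:ℝ) 1, 0 < k * (σ t + δ) ∧ k * (σ t + δ) ≤ π / 2 := fun t ht => by
    have h0 := hσmono ht.1
    have h1 := hσmono ht.2
    refine ⟨mul_pos hkpos (by linarith), hkS ▸ ?_⟩
    gcongr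
    linarith
  have hsin : ∀ t ∈ Icc (0:ℝ) 1, 0 < sin (k * (σ t + δ)) := fun t ht =>
    sin_pos_of_pos_of_lt_pi (hang t ht).1 (by linarith [(hang t ht).2, pi_pos])
  set g : ℝ → ℝ := fun t => 2 * k * (cos (k * (σ t + δ)) / sin (k * (σ t + δ))) with hg
  have hgd : ∀ t ∈ Icc (0:ℝ) 1,
      HasDerivAt g (-(2 * k ^ 2 / sin (k * (σ t + δ)) ^ 2) / L t) t := fun t ht => by
    have hθ : HasDerivAt (fun t => k * (σ t + δ)) (k * (1 / M t)) t :=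
      ((hσd t).add_const δ).const_mul k
    have hs := (hsin t ht).ne'
    have hMt := (hMpos t).ne'
    refine ((hθ.cos.fun_div hθ.sin hs).const_mul (2 * k)).congr_deriv ?_
    rw [← hML t ht.1]
    field_simp
    linear_combination (-(1:ℝ)) * sin_sq_add_cos_sq (k * (σ t + δ))
  have hgAC : AbsolutelyContinuousOnInterval g 0 1 := by
    refine ContDiffOn.absolutelyContinuousOnInterval ?_
    rw [uIcc_of_le zero_le_one]
    have hθ : ContDiff ℝ 1 fun t => k * (σ t + δ) := contDiff_const.mul (hσC.add contDiff_const)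
    exact contDiffOn_const.mul (hθ.cos.contDiffOn.div hθ.sin.contDiffOn fun t ht => (hsin t ht).ne')
  have hLAC : AbsolutelyContinuousOnInterval L 0 1 :=
    (hw.intervalIntegrable.absolutelyContinuousOnInterval_intervalIntegral (by simp)).add
      (contDiff_const.contDiffOn.absolutelyContinuousOnInterval)
  have hparts := hLAC.integral_deriv_mul_eq_sub hgAC
  have hint : IntervalIntegrable (fun t => deriv L t * g t + L t * deriv g t) volume 0 1 :=
    (hLAC.intervalIntegrable_deriv.mul_continuousOn hgAC.continuousOn).add
      (hgAC.intervalIntegrable_deriv.continuousOn_mul hLAC.continuousOn)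
  have hle : ∫ t in (0:ℝ)..1, (deriv L t * g t + L t * deriv g t + 2 * k ^ 2)
      ≤ ∫ t in (0:ℝ)..1, 1 / 2 * w t ^ 2 := by
    refine intervalIntegral.integral_mono_ae_restrict zero_le_one
      (hint.add intervalIntegrable_const) (hw2.const_mul _).intervalIntegrable ?_
    filter_upwards [ae_restrict_mem measurableSet_Icc, ae_restrict_of_ae
      (hw.intervalIntegrable (a := 0) (b := 1)).ae_hasDerivAt_integral] with t ht hLt
    have hLd : HasDerivAt L (w t) t :=
      (hLt (by rwa [uIcc_of_le zero_le_one]) 0 (by simp)).add_const η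
    have hLpos : 0 < L t := hML t ht.1 ▸ hMpos t
    have hs := (hsin t ht).ne'
    rw [hLd.deriv, (hgd t ht).deriv, mul_div_cancel₀ _ hLpos.ne']
    have hg2 : g t ^ 2 = 4 * (k ^ 2 / sin (k * (σ t + δ)) ^ 2) - 4 * k ^ 2 := by
      simp only [hg]
      field_simp
      linear_combination 4 * sin_sq_add_cos_sq (k * (σ t + δ))
    have := sq_nonneg (w t - g t)
    rw [mul_div_assoc]
    nlinarith
  rw [intervalIntegral.integral_add hint intervalIntegrable_const, hparts,
    intervalIntegral.integral_const, intervalIntegral.integral_const_mul] at hle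
  have hL0 : L 0 = η := by simp [hL]
  have hL1 : 0 ≤ L 1 := (hML 1 zero_le_one ▸ hMpos 1).le
  have hg0 : g 0 = 2 * k * (cos (k * δ) / sin (k * δ)) := by simp [hg, hσ0]
  have hg1 : 0 ≤ g 1 := by
    have h1 := hang 1 (by simp)
    have := cos_nonneg_of_neg_pi_div_two_le_of_le (by linarith [pi_pos]) h1.2
    have := hsin 1 (by simp)
    positivity
  rw [hL0, hg0] at hle
  simp only [sub_zero, one_smul] at hle
  nlinarith [mul_nonneg hL1 hg1]

/-- The action of a one-dimensional Kepler ejection of duration one. -/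
lemma kepler_ejection_action_ge {w : ℝ → ℝ} (hw : Integrable w) (hw0 : ∀ t, 0 ≤ w t)
    (hw2 : Integrable fun t => w t ^ 2) {S K : ℝ} (hS0 : 0 ≤ S)
    (hS : ∀ η > 0, ∫ t in (0:ℝ)..1, 1 / ((∫ s in (0:ℝ)..t, w s) + η) ≤ S)
    (hK : 0 ≤ K) (hK3 : K ^ 3 = 16 * π ^ 2) :
    3 / 2 * K ≤ 4 * S + 1 / 2 * ∫ t in (0:ℝ)..1, w t ^ 2 := by
  set I := 1 / 2 * ∫ t in (0:ℝ)..1, w t ^ 2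
  refine le_of_forall_pos_le_add fun ε hε => ?_
  obtain ⟨δ, hδ, rfl⟩ : ∃ δ > 0, ε = 4 * δ := ⟨ε / 4, by positivity, by ring⟩
  have hT : 0 < S + δ := by linarith
  have hkin : 2 * (π / (2 * (S + δ))) ^ 2 ≤ I := by
    set k := π / (2 * (S + δ))
    set c := 2 * k * (cos (k * δ) / sin (k * δ))
    have hev : ∀ᶠ η in nhdsWithin (0:ℝ) (Ioi 0), 2 * k ^ 2 - c * η ≤ I :=
      eventually_nhdsWithin_of_forall fun η hη =>
        half_integral_sq_ge_of_integral_inv_le hw hw0 hw2 hη hδ (hS η hη)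
    have hcont : Continuous fun η : ℝ => 2 * k ^ 2 - c * η := by fun_prop
    refine le_of_tendsto ?_ hev
    simpa using (hcont.tendsto 0).mono_left nhdsWithin_le_nhds
  have hamgm : 3 / 2 * K ≤ 4 * (S + δ) + 2 * (π / (2 * (S + δ))) ^ 2 := by
    rw [div_pow, show π ^ 2 = K ^ 3 / 16 by linarith, ← sub_nonneg]
    have : 4 * (S + δ) + 2 * (K ^ 3 / 16 / (2 * (S + δ)) ^ 2) - 3 / 2 * K
        = (K - 4 * (S + δ)) ^ 2 * (K + 8 * (S + δ)) / (32 * (S + δ) ^ 2) := by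
      field_simp
      ring
    rw [this]
    positivity
  linarith

/-- The lower bound for the contribution of a pair of bodies whose mutual distance `ρ` is at most
the distance travelled from a collision at time `0`. -/
lemma pair_action_ge {w ρ : ℝ → ℝ} (hw : Integrable w) (hw0 : ∀ t, 0 ≤ w t)
    (hw2 : Integrable fun t => w t ^ 2)
    (hρ : ∀ t ∈ Icc (0:ℝ) 1, ρ t ≤ ∫ s in (0:ℝ)..t, w s)
    {K : ℝ} (hK : 0 ≤ K) (hK3 : K ^ 3 = 16 * π ^ 2) :
    ENNReal.ofReal (3 / 8 * K) ≤
      ∫⁻ t in Icc (0:ℝ) 1, (ENNReal.ofReal (1 / 8 * w t ^ 2) + (ENNReal.ofReal (ρ t))⁻¹) := by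
  have hmeas : AEMeasurable (fun t => ENNReal.ofReal (1 / 8 * w t ^ 2))
      (volume.restrict (Icc (0:ℝ) 1)) :=
    (hw2.const_mul _).aestronglyMeasurable.aemeasurable.ennreal_ofReal.restrict
  rw [lintegral_add_left' hmeas]
  set P := ∫⁻ t in Icc (0:ℝ) 1, (ENNReal.ofReal (ρ t))⁻¹ with hP
  by_cases hPtop : P = ⊤
  · simp [hPtop]
  rw [← ofReal_integral_eq_lintegral_ofReal (hw2.const_mul _).restrict
      (ae_of_all _ fun t => by positivity), ← ENNReal.ofReal_toReal hPtop,
    ← ENNReal.ofReal_add (integral_nonneg fun t => by positivity) ENNReal.toReal_nonneg]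
  refine ENNReal.ofReal_le_ofReal ?_
  have hS : ∀ η > 0, ∫ t in (0:ℝ)..1, 1 / ((∫ s in (0:ℝ)..t, w s) + η) ≤ P.toReal := by
    intro η hη
    have hLnn : ∀ t ∈ Icc (0:ℝ) 1, 0 ≤ ∫ s in (0:ℝ)..t, w s := fun t ht =>
      intervalIntegral.integral_nonneg ht.1 fun s _ => hw0 s
    have hprim : Continuous fun t => ∫ s in (0:ℝ)..t, w s :=
      intervalIntegral.continuous_primitive (fun a b => hw.intervalIntegrable) 0
    rw [intervalIntegral.integral_of_le zero_le_one, ← integral_Icc_eq_integral_Ioc,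
      integral_eq_lintegral_of_nonneg_ae]
    · refine ENNReal.toReal_mono hPtop (setLIntegral_mono' measurableSet_Icc fun t ht => ?_)
      have := hLnn t ht
      rw [one_div, ENNReal.ofReal_inv_of_pos (by positivity), ENNReal.inv_le_inv]
      exact ENNReal.ofReal_le_ofReal (by linarith [hρ t ht])
    · filter_upwards [ae_restrict_mem measurableSet_Icc] with t ht
      have := hLnn t ht
      simp only [Pi.zero_apply]
      positivity
    · exact (((hprim.add continuous_const).measurable.const_div 1).aestronglyMeasurable).restrict
  have h := kepler_ejection_action_ge hw hw0 hw2 ENNReal.toReal_nonneg hS hK hK3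
  rw [intervalIntegral.integral_of_le zero_le_one, ← integral_Icc_eq_integral_Ioc] at h
  rw [integral_const_mul]
  linarith

lemma enorm2_eq_norm (v : ℝ × ℝ) : enorm2 v = ‖Complex.equivRealProdCLM.symm v‖ := by
  rw [Complex.norm_eq_sqrt_sq_add_sq]
  simp [enorm2]

lemma enorm2_nonneg (v : ℝ × ℝ) : 0 ≤ enorm2 v := Real.sqrt_nonneg _

lemma enorm2_sq (v : ℝ × ℝ) : enorm2 v ^ 2 = v.1 ^ 2 + v.2 ^ 2 := Real.sq_sqrt (by positivity)

lemma enorm2_neg (v : ℝ × ℝ) : enorm2 (-v) = enorm2 v := by simp [enorm2]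

lemma continuous_enorm2 : Continuous enorm2 := by
  unfold enorm2
  fun_prop

lemma integrableOn_enorm2 {u : ℝ → ℝ × ℝ} {s : Set ℝ} (hu : IntegrableOn u s) :
    IntegrableOn (fun t => enorm2 (u t)) s := by
  simp only [enorm2_eq_norm]
  exact (Complex.equivRealProdCLM.symm.toContinuousLinearMap.integrable_comp hu).norm

lemma enorm2_integral_le {u : ℝ → ℝ × ℝ} {a b : ℝ} (hab : a ≤ b) :
    enorm2 (∫ t in a..b, u t) ≤ ∫ t in a..b, enorm2 (u t) := by
  simp only [enorm2_eq_norm]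
  rw [intervalIntegral.integral_of_le hab, intervalIntegral.integral_of_le hab,
    ← Complex.equivRealProdCLM.symm.integral_comp_comm]
  exact norm_integral_le_integral_norm _

/-- The pair bound for a planar relative position `r` with velocity `u`, vanishing at an
endpoint of `[0,1]`. -/
lemma planar_pair_action_ge {r u : ℝ → ℝ × ℝ} (hu : IntegrableOn u (Icc (0:ℝ) 1))
    (hr : ∀ t ∈ Icc (0:ℝ) 1, r t = r 0 + ∫ s in (0:ℝ)..t, u s)
    (hu2 : IntegrableOn (fun t => enorm2 (u t) ^ 2) (Icc (0:ℝ) 1))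
    {t₀ : ℝ} (ht₀ : t₀ = 0 ∨ t₀ = 1) (hcol : r t₀ = 0)
    {K : ℝ} (hK : 0 ≤ K) (hK3 : K ^ 3 = 16 * π ^ 2) :
    ENNReal.ofReal (3 / 8 * K) ≤ ∫⁻ t in Icc (0:ℝ) 1,
      (ENNReal.ofReal (1 / 8 * enorm2 (u t) ^ 2) + (ENNReal.ofReal (enorm2 (r t)))⁻¹) := by
  set w : ℝ → ℝ := (Icc (0:ℝ) 1).indicator fun t => enorm2 (u t) with hw
  have hwint : Integrable w := (integrable_indicator_iff measurableSet_Icc).2 (integrableOn_enorm2 hu)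
  have hw0 : ∀ t, 0 ≤ w t := indicator_nonneg fun t _ => enorm2_nonneg _
  have hwsq : (fun t => w t ^ 2) = (Icc (0:ℝ) 1).indicator fun t => enorm2 (u t) ^ 2 := by
    ext t
    by_cases ht : t ∈ Icc (0:ℝ) 1 <;> simp [hw, ht]
  have hw2 : Integrable fun t => w t ^ 2 := by
    rw [hwsq]
    exact (integrable_indicator_iff measurableSet_Icc).2 hu2
  have hbound : ∀ a ∈ Icc (0:ℝ) 1, ∀ b ∈ Icc (0:ℝ) 1, a ≤ b →
      enorm2 (∫ s in a..b, u s) ≤ ∫ s in a..b, w s := fun a ha b hb hab => by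
    refine (enorm2_integral_le hab).trans_eq (intervalIntegral.integral_congr fun s hs => ?_)
    rw [uIcc_of_le hab] at hs
    have hs' : s ∈ Icc (0:ℝ) 1 := ⟨ha.1.trans hs.1, hs.2.trans hb.2⟩
    simp only [hw, indicator_of_mem hs']
  have hcongr : ∫⁻ t in Icc (0:ℝ) 1,
        (ENNReal.ofReal (1 / 8 * enorm2 (u t) ^ 2) + (ENNReal.ofReal (enorm2 (r t)))⁻¹)
      = ∫⁻ t in Icc (0:ℝ) 1,
        (ENNReal.ofReal (1 / 8 * w t ^ 2) + (ENNReal.ofReal (enorm2 (r t)))⁻¹) :=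
    setLIntegral_congr_fun measurableSet_Icc fun t ht => by simp only [hw, indicator_of_mem ht]
  rw [hcongr]
  rcases ht₀ with rfl | rfl
  · refine pair_action_ge hwint hw0 hw2 (fun t ht => ?_) hK hK3
    rw [hr t ht, hcol, zero_add]
    exact hbound 0 (left_mem_Icc.2 zero_le_one) t ht ht.1
  · have hmp : MeasurePreserving (fun t : ℝ => 1 - t) := volume.measurePreserving_sub_left 1
    have hpre : (fun t : ℝ => 1 - t) ⁻¹' Icc 0 1 = Icc 0 1 := by simp
    rw [← hmp.setLIntegral_comp_preimage_emb (measurableEmbedding_subLeft 1), hpre]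
    refine pair_action_ge (w := fun t => w (1 - t)) (ρ := fun t => enorm2 (r (1 - t)))
      (hwint.comp_sub_left 1) (fun t => hw0 _) (hw2.comp_sub_left 1) (fun t ht => ?_) hK hK3
    have ht' : 1 - t ∈ Icc (0:ℝ) 1 := ⟨by linarith [ht.2], by linarith [ht.1]⟩
    have hui : ∀ a ∈ Icc (0:ℝ) 1, ∀ b ∈ Icc (0:ℝ) 1, IntervalIntegrable u volume a b :=
      fun a ha b hb => (hu.mono_set (uIcc_subset_Icc ha hb)).intervalIntegrable
    have hrt : r (1 - t) = -∫ s in (1 - t)..1, u s := by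
      have h1 := hr 1 (by simp)
      rw [hcol, ← intervalIntegral.integral_add_adjacent_intervals
        (hui 0 (left_mem_Icc.2 zero_le_one) _ ht')
        (hui _ ht' 1 (right_mem_Icc.2 zero_le_one)), ← add_assoc, ← hr _ ht'] at h1
      exact eq_neg_of_add_eq_zero_left h1.symm
    rw [hrt, enorm2_neg, intervalIntegral.integral_comp_sub_left, sub_zero]
    exact hbound _ ht' 1 (by simp) ht'.2

/-- The kinetic energy dominates the sum of its pairwise relative parts. -/
lemma sum_pairs_kinetic_le (v : Fin 4 → ℝ × ℝ) :
    ∑ i : Fin 4, ∑ j ∈ Finset.univ.filter (fun j => i < j), 1 / 8 * enorm2 (v i - v j) ^ 2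
      ≤ 1 / 2 * ∑ i, enorm2 (v i) ^ 2 := by
  simp only [Finset.sum_filter, Fin.sum_univ_four, enorm2_sq, Prod.fst_sub, Prod.snd_sub]
  simp only [show ((0:Fin 4) < 0) = False by decide, show ((0:Fin 4) < 1) = True by decide,
    show ((0:Fin 4) < 2) = True by decide, show ((0:Fin 4) < 3) = True by decide,
    show ((1:Fin 4) < 0) = False by decide, show ((1:Fin 4) < 1) = False by decide,
    show ((1:Fin 4) < 2) = True by decide, show ((1:Fin 4) < 3) = True by decide,
    show ((2:Fin 4) < 0) = False by decide, show ((2:Fin 4) < 1) = False by decide,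
    show ((2:Fin 4) < 2) = False by decide, show ((2:Fin 4) < 3) = True by decide,
    show ((3:Fin 4) < 0) = False by decide, show ((3:Fin 4) < 1) = False by decide,
    show ((3:Fin 4) < 2) = False by decide, show ((3:Fin 4) < 3) = False by decide,
    if_true, if_false]
  nlinarith [sq_nonneg ((v 0).1 + (v 1).1 + (v 2).1 + (v 3).1),
    sq_nonneg ((v 0).2 + (v 1).2 + (v 2).2 + (v 3).2)]

lemma sum_lintegral_le {α ι : Type*} [MeasurableSpace α] {μ : Measure α} (s : Finset ι)
    (f : ι → α → ℝ≥0∞) : ∑ i ∈ s, ∫⁻ a, f i a ∂μ ≤ ∫⁻ a, ∑ i ∈ s, f i a ∂μ := by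
  classical
  induction s using Finset.induction_on with
  | empty => simp
  | insert i s hi ih =>
    simp only [Finset.sum_insert hi]
    exact (add_le_add_right ih _).trans (le_lintegral_add _ _)

lemma H1Path4.integrableOn_enorm2_sub_sq (p : H1Path4) (i j : Fin 4) :
    IntegrableOn (fun t => enorm2 (p.v t i - p.v t j) ^ 2) (Icc (0:ℝ) 1) := by
  refine Integrable.mono' (((p.hL2 i).add (p.hL2 j)).const_mul 2) ?_ (ae_of_all _ fun t => ?_)
  · exact (continuous_enorm2.pow 2).comp_aestronglyMeasurable
      ((p.hvInt i).sub (p.hvInt j)).aestronglyMeasurable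
  · rw [Real.norm_of_nonneg (by positivity)]
    simp only [Pi.add_apply, enorm2_sq, Prod.fst_sub, Prod.snd_sub]
    nlinarith [sq_nonneg ((p.v t i).1 + (p.v t j).1), sq_nonneg ((p.v t i).2 + (p.v t j).2)]

/-- The action dominates the sum of the pairwise relative actions. -/
lemma sum_pair_actions_le_action (p : H1Path4) :
    ∑ i : Fin 4, ∑ j ∈ Finset.univ.filter (fun j => i < j), ∫⁻ t in Icc (0:ℝ) 1,
      (ENNReal.ofReal (1 / 8 * enorm2 (p.v t i - p.v t j) ^ 2)
        + (ENNReal.ofReal (enorm2 (p.q t i - p.q t j)))⁻¹) ≤ action p := by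
  refine (Finset.sum_le_sum fun i _ => sum_lintegral_le _ _).trans
    ((sum_lintegral_le _ _).trans (lintegral_mono fun t => ?_))
  simp only [Finset.sum_add_distrib]
  refine add_le_add_left ?_ _
  refine le_of_eq_of_le ?_ (ENNReal.ofReal_le_ofReal (sum_pairs_kinetic_le (p.v t)))
  rw [ENNReal.ofReal_sum_of_nonneg fun i _ => Finset.sum_nonneg fun j _ => by positivity]
  exact Finset.sum_congr rfl fun i _ =>
    (ENNReal.ofReal_sum_of_nonneg fun j _ => by positivity).symm

/-- a path in `H¹([0,1],χ)` with a total collision at an endpoint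
has action at least `(6/4)·(3/2)·(16π²)^{1/3} ≥ 12.16`. -/
theorem statement12 (p : H1Path4) (hchi : p.inChi)
    (t₀ : ℝ) (ht₀ : t₀ = 0 ∨ t₀ = 1)
    (hcol : p.q t₀ 0 = p.q t₀ 1 ∧ p.q t₀ 1 = p.q t₀ 2 ∧ p.q t₀ 2 = p.q t₀ 3) :
    ENNReal.ofReal ((6/4) * (3/2) * (16 * π^2) ^ ((1:ℝ)/3)) ≤ action p ∧
    ENNReal.ofReal 12.16 ≤ action p := by
  set K : ℝ := (16 * π ^ 2) ^ ((1:ℝ) / 3) with hKdef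
  have hK : 0 ≤ K := by positivity
  have hK3 : K ^ 3 = 16 * π ^ 2 := by
    rw [hKdef, ← Real.rpow_natCast, ← Real.rpow_mul (by positivity)]
    norm_num
  have hall : ∀ i j, p.q t₀ i = p.q t₀ j := by
    obtain ⟨h1, h2, h3⟩ := hcol
    have h0 : ∀ i, p.q t₀ i = p.q t₀ 0 := fun i => by
      fin_cases i <;> simp [h1, h2, h3]
    exact fun i j => (h0 i).trans (h0 j).symm
  have hpair : ∀ i j, ENNReal.ofReal (3 / 8 * K) ≤ ∫⁻ t in Icc (0:ℝ) 1,
      (ENNReal.ofReal (1 / 8 * enorm2 (p.v t i - p.v t j) ^ 2)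
        + (ENNReal.ofReal (enorm2 (p.q t i - p.q t j)))⁻¹) := fun i j => by
    refine planar_pair_action_ge (r := fun t => p.q t i - p.q t j)
      ((p.hvInt i).sub (p.hvInt j)) (fun t ht => ?_) (p.integrableOn_enorm2_sub_sq i j) ht₀
      (sub_eq_zero.2 (hall i j)) hK hK3
    have hii : ∀ i, IntervalIntegrable (fun s => p.v s i) volume 0 t := fun i =>
      ((p.hvInt i).mono_set (uIcc_subset_Icc (by simp) ht)).intervalIntegrable
    simp only [Pi.sub_apply]
    rw [intervalIntegral.integral_sub (hii i) (hii j), p.hrep i t ht, p.hrep j t ht]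
    abel
  have hmain : ENNReal.ofReal ((6 / 4) * (3 / 2) * K) ≤ action p := by
    refine le_of_eq_of_le ?_ ((Finset.sum_le_sum fun i _ => Finset.sum_le_sum
      fun j _ => hpair i j).trans (sum_pair_actions_le_action p))
    rw [Finset.sum_congr rfl fun i _ => Finset.sum_const _, ← Finset.sum_smul,
      show ∑ i : Fin 4, (Finset.univ.filter (fun j => i < j)).card = 6 by decide,
      ← ENNReal.ofReal_nsmul]
    congr 1
    rw [nsmul_eq_mul]
    push_cast
    ring
  refine ⟨hmain, (ENNReal.ofReal_le_ofReal ?_).trans hmain⟩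
  have hKge : (12.16 * 4 / 9 : ℝ) ≤ K := by
    refine le_of_pow_le_pow_left₀ three_ne_zero hK ?_
    rw [hK3]
    nlinarith [pi_gt_d4]
  linarith

end
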